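/- arXiv:1407.7882 — 4 statements merged into one kernel-verified Lean document; each statement's English description precedes it below -/
import Mathlib

section
/- Let M be a matching in a finite simple graph G, suppose an M-augmenting path exists, and let k denote the length of a shortest M-augmenting path. Let P* be a maximal (with respect to set inclusion) collection of pairwise vertex-disjoint M-augmenting paths each of length exactly k. Then M ⊕ E(P*) is a matching, and every (M ⊕ E(P*))-augmenting path has length at least k + 2. -/
/-- `M` is a matching in `G`: a set of edges of `G`, no two of which share an endpoint. -/
def IsEdgeMatching {V : Type*} (G : SimpleGraph V) (M : Set (Sym2 V)) : Prop :=
  M ⊆ G.edgeSet ∧ ∀ e ∈ M, ∀ f ∈ M, e ≠ f → ∀ x : V, ¬(x ∈ e ∧ x ∈ f)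

/-- A walk `p` from `u` to `v` is an `M`-augmenting path: it is a path with distinct
endpoints, its edges alternate between edges of `M` and edges not in `M`, and both of
its endpoints are `M`-free. -/
def IsAugPath {V : Type*} {G : SimpleGraph V} (M : Set (Sym2 V)) {u v : V}
    (p : G.Walk u v) : Prop :=
  p.IsPath ∧ u ≠ v ∧
    List.Chain' (fun e f => ¬(e ∈ M ↔ f ∈ M)) p.edges ∧
    (∀ e ∈ M, u ∉ e) ∧ (∀ e ∈ M, v ∉ e)

/-- A walk in `G` bundled together with its endpoints. -/
abbrev PathSig {V : Type*} (G : SimpleGraph V) := Σ u : V, Σ v : V, G.Walk u v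

/-- Two bundled walks are vertex-disjoint: they share no vertex. -/
def VDisj {V : Type*} {G : SimpleGraph V} (p q : PathSig G) : Prop :=
  ∀ x : V, x ∈ p.2.2.support → x ∉ q.2.2.support

/-- The set of edges appearing in a collection of bundled walks. -/
def pathsEdges {V : Type*} {G : SimpleGraph V} (P : Set (PathSig G)) : Set (Sym2 V) :=
  {e | ∃ p ∈ P, e ∈ p.2.2.edges}

section AlternatingPaths

variable {V : Type*} {G : SimpleGraph V} {M N : Set (Sym2 V)} {u v : V}

/-- Consecutive entries of the list `l` alternate between `M` and its complement. -/
abbrev Alternates (M : Set (Sym2 V)) (l : List (Sym2 V)) : Prop :=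
  l.IsChain fun e f => ¬(e ∈ M ↔ f ∈ M)

lemma Alternates.congr {l : List (Sym2 V)} (h : Alternates M l)
    (hMN : ∀ e ∈ l, (e ∈ M ↔ e ∈ N)) : Alternates N l :=
  h.imp_of_mem_imp fun e f he hf hef => by rwa [← hMN e he, ← hMN f hf]

lemma Alternates.compl {l : List (Sym2 V)} (h : Alternates M l)
    (hMN : ∀ e ∈ l, (e ∈ M ↔ e ∉ N)) : Alternates N l :=
  h.imp_of_mem_imp fun e f he hf hef => by
    have := hMN e he
    have := hMN f hf
    tauto

lemma IsEdgeMatching.eq_of_mem (hM : IsEdgeMatching G M) {e f : Sym2 V} (he : e ∈ M)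
    (hf : f ∈ M) {x : V} (hxe : x ∈ e) (hxf : x ∈ f) : e = f :=
  by_contra fun h => hM.2 e he f hf h x ⟨hxe, hxf⟩

lemma IsEdgeMatching.subset (hM : IsEdgeMatching G M) (h : N ⊆ M) : IsEdgeMatching G N :=
  ⟨h.trans hM.1, fun e he f hf => hM.2 e (h he) f (h hf)⟩

lemma SimpleGraph.Walk.mem_support_of_mem_of_mem_edges {p : G.Walk u v} {e : Sym2 V} {x : V}
    (he : e ∈ p.edges) (hx : x ∈ e) : x ∈ p.support := by
  induction e with
  | h a b =>
    rcases Sym2.mem_iff.1 hx with rfl | rfl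
    · exact p.fst_mem_support_of_mem_edges he
    · exact p.snd_mem_support_of_mem_edges he

lemma SimpleGraph.Walk.exists_mem_edges_of_mem_support {p : G.Walk u v} (huv : u ≠ v) {x : V}
    (hx : x ∈ p.support) : ∃ e ∈ p.edges, x ∈ e :=
  (p.mem_support_iff_exists_mem_edges_of_not_nil fun h => huv h.eq).1 hx

lemma SimpleGraph.Walk.IsPath.index_of_getVert_mem {p : G.Walk u v} (hp : p.IsPath) {i j : ℕ}
    (hi : i ≤ p.length) (hj : j < p.edges.length) (h : p.getVert i ∈ p.edges[j]) :
    j = i ∨ j + 1 = i := by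
  rw [SimpleGraph.Walk.getElem_edges, Sym2.mem_iff] at h
  rw [SimpleGraph.Walk.length_edges] at hj
  rcases h with h | h
  · exact Or.inl (hp.getVert_injOn hi (by simp; lia) h).symm
  · exact Or.inr (hp.getVert_injOn hi (by simp; lia) h).symm

lemma SimpleGraph.Walk.IsPath.edge_unique_start {p : G.Walk u v} (hp : p.IsPath) {e f : Sym2 V}
    (he : e ∈ p.edges) (hf : f ∈ p.edges) (hue : u ∈ e) (huf : u ∈ f) : e = f := by
  obtain ⟨i, hi, rfl⟩ := List.getElem_of_mem he
  obtain ⟨j, hj, rfl⟩ := List.getElem_of_mem hf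
  have h1 := hp.index_of_getVert_mem (i := 0) (Nat.zero_le _) hi (by simpa using hue)
  have h2 := hp.index_of_getVert_mem (i := 0) (Nat.zero_le _) hj (by simpa using huf)
  obtain rfl : i = j := by lia
  rfl

lemma SimpleGraph.Walk.IsPath.edge_unique_end {p : G.Walk u v} (hp : p.IsPath) {e f : Sym2 V}
    (he : e ∈ p.edges) (hf : f ∈ p.edges) (hve : v ∈ e) (hvf : v ∈ f) : e = f :=
  hp.reverse.edge_unique_start (by simpa using he) (by simpa using hf) hve hvf

/-- An interior vertex of an alternating path lies on exactly two edges of the path,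
one inside and one outside the alternating set. -/
lemma SimpleGraph.Walk.IsPath.edges_at_vertex {p : G.Walk u v} (hp : p.IsPath)
    (hch : Alternates M p.edges) {x : V} (hx : x ∈ p.support) :
    x = u ∨ x = v ∨ ∃ e ∈ p.edges, ∃ f ∈ p.edges, x ∈ e ∧ x ∈ f ∧ e ∈ M ∧ f ∉ M ∧
      ∀ g ∈ p.edges, x ∈ g → g = e ∨ g = f := by
  obtain ⟨i, rfl, hi⟩ := SimpleGraph.Walk.mem_support_iff_exists_getVert.1 hx
  rcases Nat.eq_zero_or_pos i with rfl | hi0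
  · simp
  rcases hi.eq_or_lt with rfl | hil
  · simp
  refine Or.inr (Or.inr ?_)
  obtain ⟨j, rfl⟩ : ∃ j, i = j + 1 := ⟨i - 1, by lia⟩
  have hj : j + 1 < p.edges.length := by simpa using hil
  have hj' : j < p.edges.length := by lia
  have key : ∀ g ∈ p.edges, p.getVert (j + 1) ∈ g → g = p.edges[j] ∨ g = p.edges[j + 1] := by
    intro g hg hxg
    obtain ⟨m, hm, rfl⟩ := List.getElem_of_mem hg
    rcases hp.index_of_getVert_mem hi hm hxg with h | h
    · obtain rfl := h
      exact Or.inr rfl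
    · obtain rfl : m = j := by lia
      exact Or.inl rfl
  have h0 : p.getVert (j + 1) ∈ p.edges[j] := by simp [SimpleGraph.Walk.getElem_edges]
  have h1 : p.getVert (j + 1) ∈ p.edges[j + 1] := by simp [SimpleGraph.Walk.getElem_edges]
  have halt := List.isChain_iff_getElem.1 hch j hj
  by_cases hM : p.edges[j] ∈ M
  · exact ⟨_, List.getElem_mem hj', _, List.getElem_mem hj, h0, h1, hM, by tauto, key⟩
  · exact ⟨_, List.getElem_mem hj, _, List.getElem_mem hj', h1, h0, by tauto, hM,
      fun g hg hx => (key g hg hx).symm⟩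

/-- Flipping a matching along an alternating path leaves at most one edge at each vertex of the
path, provided the matching edges at the two ends belong to the path. -/
lemma IsEdgeMatching.symmDiff_unique_of_mem_support (hN : IsEdgeMatching G N) {p : G.Walk u v}
    (hp : p.IsPath) (hch : Alternates N p.edges) (hu : ∀ e ∈ N, u ∈ e → e ∈ p.edges)
    (hv : ∀ e ∈ N, v ∈ e → e ∈ p.edges) {x : V} (hx : x ∈ p.support) {e f : Sym2 V}
    (he : e ∈ symmDiff N {e | e ∈ p.edges}) (hf : f ∈ symmDiff N {e | e ∈ p.edges})
    (hxe : x ∈ e) (hxf : x ∈ f) : e = f := by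
  simp only [Set.mem_symmDiff, Set.mem_ofPred_eq] at he hf
  rcases hp.edges_at_vertex hch hx with rfl | rfl | ⟨e₀, he₀, f₀, hf₀, hxe₀, hxf₀, heN, hfN, huniq⟩
  · have := hu e
    have := hu f
    exact hp.edge_unique_start (by tauto) (by tauto) hxe hxf
  · have := hv e
    have := hv f
    exact hp.edge_unique_end (by tauto) (by tauto) hxe hxf
  · have key : ∀ g, (g ∈ N ∧ g ∉ p.edges ∨ g ∈ p.edges ∧ g ∉ N) → x ∈ g → g = f₀ := by
      rintro g (⟨hg, hg'⟩ | ⟨hg, hg'⟩) hxg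
      · exact absurd (hN.eq_of_mem hg heN hxg hxe₀ ▸ he₀) hg'
      · rcases huniq g hg hxg with rfl | rfl
        · exact absurd heN hg'
        · rfl
    rw [key e he hxe, key f hf hxf]

lemma IsEdgeMatching.symmDiff_path (hN : IsEdgeMatching G N) {p : G.Walk u v}
    (hp : p.IsPath) (hch : Alternates N p.edges) (hu : ∀ e ∈ N, u ∈ e → e ∈ p.edges)
    (hv : ∀ e ∈ N, v ∈ e → e ∈ p.edges) :
    IsEdgeMatching G (symmDiff N {e | e ∈ p.edges}) := by
  refine ⟨?_, fun e he f hf hne x ⟨hxe, hxf⟩ => ?_⟩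
  · rintro e (⟨he, -⟩ | ⟨he, -⟩)
    · exact hN.1 he
    · exact p.edges_subset_edgeSet he
  · by_cases hx : x ∈ p.support
    · exact hne (hN.symmDiff_unique_of_mem_support hp hch hu hv hx he hf hxe hxf)
    · rcases he with ⟨he, -⟩ | ⟨he, -⟩
      · rcases hf with ⟨hf, -⟩ | ⟨hf, -⟩
        · exact hne (hN.eq_of_mem he hf hxe hxf)
        · exact hx (SimpleGraph.Walk.mem_support_of_mem_of_mem_edges hf hxf)
      · exact hx (SimpleGraph.Walk.mem_support_of_mem_of_mem_edges he hxe)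

open scoped Classical in
lemma Alternates.two_mul_countP (a : Sym2 V) (l : List (Sym2 V)) (h : Alternates M (a :: l)) :
    2 * (a :: l).countP (· ∈ M) + 1 = (a :: l).length + (if a ∈ M then 1 else 0) +
      (if (a :: l).getLast (List.cons_ne_nil _ _) ∈ M then 1 else 0) := by
  induction l generalizing a with
  | nil => by_cases ha : a ∈ M <;> simp [ha]
  | cons b l ih =>
    rw [Alternates, List.isChain_cons_cons] at h
    have := ih b h.2
    rw [List.countP_cons, List.getLast_cons (List.cons_ne_nil _ _), List.length_cons]
    have h1 := h.1
    by_cases ha : a ∈ M <;> by_cases hb : b ∈ M <;> simp [ha, hb] at this h1 ⊢ <;> lia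

open scoped Classical in
lemma List.Nodup.ncard_inter {l : List (Sym2 V)} (h : l.Nodup) :
    ({e | e ∈ l} ∩ M).ncard = l.countP (· ∈ M) := by
  have : ({e | e ∈ l} ∩ M) = ((l.filter (· ∈ M)).toFinset : Set (Sym2 V)) := by
    ext e
    simp
  rw [this, Set.ncard_coe_finset, List.toFinset_card_of_nodup (h.filter _), List.countP_eq_length_filter]

lemma List.Nodup.ncard_eq_length {l : List (Sym2 V)} (h : l.Nodup) :
    {e | e ∈ l}.ncard = l.length := by
  simpa using h.ncard_inter (M := Set.univ)

end AlternatingPaths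

section Augmenting

variable {V : Type*} {G : SimpleGraph V} {M N : Set (Sym2 V)} {u v : V} {p : G.Walk u v}

lemma IsAugPath.alternates (h : IsAugPath M p) : Alternates M p.edges := h.2.2.1

lemma IsAugPath.reverse (h : IsAugPath M p) : IsAugPath M p.reverse := by
  refine ⟨h.1.reverse, h.2.1.symm, ?_, h.2.2.2.2, h.2.2.2.1⟩
  have : Alternates M p.reverse.edges := by
    rw [SimpleGraph.Walk.edges_reverse, Alternates, List.isChain_reverse]
    exact h.alternates.imp fun e f hef => by tauto
  exact this

lemma IsAugPath.symmDiff_unique_of_mem_support (h : IsAugPath M p) (hM : IsEdgeMatching G M)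
    {x : V} (hx : x ∈ p.support) {e f : Sym2 V}
    (he : e ∈ symmDiff M {e | e ∈ p.edges}) (hf : f ∈ symmDiff M {e | e ∈ p.edges})
    (hxe : x ∈ e) (hxf : x ∈ f) : e = f :=
  hM.symmDiff_unique_of_mem_support h.1 h.alternates
    (fun e he hu => absurd hu (h.2.2.2.1 e he)) (fun e he hv => absurd hv (h.2.2.2.2 e he))
    hx he hf hxe hxf

lemma IsAugPath.isEdgeMatching_symmDiff (h : IsAugPath M p) (hM : IsEdgeMatching G M) :
    IsEdgeMatching G (symmDiff M {e | e ∈ p.edges}) :=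
  hM.symmDiff_path h.1 h.alternates
    (fun e he hu => absurd hu (h.2.2.2.1 e he)) (fun e he hv => absurd hv (h.2.2.2.2 e he))

lemma IsAugPath.exists_edge_notMem (h : IsAugPath M p) {x : V} (hx : x ∈ p.support) :
    ∃ e ∈ p.edges, x ∈ e ∧ e ∉ M := by
  rcases h.1.edges_at_vertex h.alternates hx with rfl | rfl | ⟨-, -, f, hf, -, hxf, -, hfM, -⟩
  · obtain ⟨e, he, hxe⟩ := SimpleGraph.Walk.exists_mem_edges_of_mem_support h.2.1 hx
    exact ⟨e, he, hxe, fun hM => h.2.2.2.1 e hM hxe⟩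
  · obtain ⟨e, he, hxe⟩ := SimpleGraph.Walk.exists_mem_edges_of_mem_support h.2.1 hx
    exact ⟨e, he, hxe, fun hM => h.2.2.2.2 e hM hxe⟩
  · exact ⟨f, hf, hxf, hfM⟩

lemma IsAugPath.exists_edge_mem (h : IsAugPath M p) {x : V} (hx : x ∈ p.support) (hu : x ≠ u)
    (hv : x ≠ v) : ∃ e ∈ p.edges, x ∈ e ∧ e ∈ M := by
  rcases h.1.edges_at_vertex h.alternates hx with h' | h' | ⟨e, he, -, -, hxe, -, heM, -, -⟩
  · exact absurd h' hu
  · exact absurd h' hv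
  · exact ⟨e, he, hxe, heM⟩

lemma IsAugPath.two_mul_ncard_inter (h : IsAugPath M p) :
    2 * ({e | e ∈ p.edges} ∩ M).ncard + 1 = p.length := by
  classical
  rw [h.1.isTrail.edges_nodup.ncard_inter, ← p.length_edges]
  obtain ⟨-, huv, hch, hu, hv⟩ := h
  match hE : p.edges with
  | [] => exact absurd (SimpleGraph.Walk.edges_eq_nil.1 hE).eq huv
  | a :: l =>
    rw [hE] at hch
    rw [Alternates.two_mul_countP a l hch]
    have h1 : a ∉ M := by
      intro ha
      apply hu a ha
      have h0 : 0 < p.edges.length := by simp [hE]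
      have := SimpleGraph.Walk.getElem_edges h0
      simp only [hE, List.getElem_cons_zero, SimpleGraph.Walk.getVert_zero] at this
      simp [this]
    have h2 : (a :: l).getLast (List.cons_ne_nil _ _) ∉ M := by
      intro ha
      apply hv _ ha
      have h0 : p.length - 1 < p.edges.length := by
        have := congrArg List.length hE
        simp at this ⊢
        lia
      have := SimpleGraph.Walk.getElem_edges h0
      have hl : p.length - 1 + 1 = p.length := by
        simp at h0
        lia
      rw [hl, SimpleGraph.Walk.getVert_length] at this
      rw [List.getLast_eq_getElem]
      simp only [← hE, SimpleGraph.Walk.length_edges, this]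
      simp
    simp [h1, h2]

end Augmenting

section Counting

variable {V : Type*} {G : SimpleGraph V} {M : Set (Sym2 V)}

lemma Set.Finite.ncard_biUnion_const {ι α : Type*} {t : Set ι} (ht : t.Finite) {s : ι → Set α}
    {c : ℕ} (hs : ∀ i ∈ t, (s i).Finite) (hd : t.PairwiseDisjoint s)
    (hc : ∀ i ∈ t, (s i).ncard = c) : (⋃ i ∈ t, s i).ncard = t.ncard * c := by
  rw [ht.ncard_biUnion hs hd, finsum_mem_congr rfl hc, finsum_mem_eq_finite_toFinset_sum _ ht,
    Set.ncard_eq_toFinset_card t ht]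
  simp

lemma Set.ncard_symmDiff_add {α : Type*} [Finite α] (s t : Set α) :
    (symmDiff s t).ncard + 2 * (s ∩ t).ncard = s.ncard + t.ncard := by
  have h1 := Set.ncard_inter_add_ncard_sdiff_eq_ncard s t
  have h2 := Set.ncard_inter_add_ncard_sdiff_eq_ncard t s
  have h3 : (symmDiff s t).ncard = (s \ t).ncard + (t \ s).ncard :=
    Set.ncard_union_eq (Set.disjoint_left.2 fun x hx hx' => hx.2 hx'.1)
  rw [Set.inter_comm t s] at h2
  lia

lemma IsEdgeMatching.ncard_covered [Finite V] (hM : IsEdgeMatching G M) :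
    {x | ∃ e ∈ M, x ∈ e}.ncard = M.ncard * 2 := by
  classical
  have : {x | ∃ e ∈ M, x ∈ e} = ⋃ e ∈ M, {x | x ∈ e} := by
    ext x
    simp
  rw [this]
  refine M.toFinite.ncard_biUnion_const (fun _ _ => Set.toFinite _) ?_ fun e he => ?_
  · intro e he f hf hne
    exact Set.disjoint_left.2 fun x hx hx' => hM.2 e he f hf hne x ⟨hx, hx'⟩
  · have h2 := Sym2.card_toFinset_of_not_isDiag e (G.not_isDiag_of_mem_edgeSet (hM.1 he))
    rw [← h2, ← Set.ncard_coe_finset]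
    congr 1
    ext x
    simp

lemma IsEdgeMatching.exists_covered_of_ncard_lt [Finite V] {A B : Set (Sym2 V)}
    (hA : IsEdgeMatching G A) (hB : IsEdgeMatching G B) (h : A.ncard < B.ncard) :
    ∃ u v, s(u, v) ∈ B ∧ ∀ e ∈ A, u ∉ e := by
  by_contra! hcon
  have hsub : {x | ∃ e ∈ B, x ∈ e} ⊆ {x | ∃ e ∈ A, x ∈ e} := by
    rintro x ⟨e, he, hx⟩
    obtain ⟨y, rfl⟩ := Sym2.mem_iff_exists.1 hx
    exact hcon x y he
  have := Set.ncard_le_ncard hsub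
  rw [hA.ncard_covered, hB.ncard_covered] at this
  lia

end Counting

section Berge

variable {V : Type*} {G : SimpleGraph V} {A B : Set (Sym2 V)}

/-- An augmenting path avoiding `u`, `v` for the matchings obtained by deleting the edge `uv` of
`B` and the edge `vw` of `A` can be turned into an augmenting path for `A` itself. -/
lemma exists_augPath_of_delete (hA : IsEdgeMatching G A) (hB : IsEdgeMatching G B) {u v w a b : V}
    (huB : s(u, v) ∈ B) (hvA : s(v, w) ∈ A) (hu : ∀ e ∈ A, u ∉ e) {q : G.Walk a b}
    (hq : IsAugPath (A \ {s(v, w)}) q)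
    (hqe : ∀ e ∈ q.edges, e ∈ symmDiff (A \ {s(v, w)}) (B \ {s(u, v)})) :
    ∃ (c d : V) (p : G.Walk c d), IsAugPath A p ∧ ∀ e ∈ p.edges, e ∈ symmDiff A B := by
  have huw : u ≠ w := by
    rintro rfl
    exact hu _ hvA (by simp)
  have hun : u ∉ q.support := by
    intro h
    obtain ⟨e, he, hue⟩ := SimpleGraph.Walk.exists_mem_edges_of_mem_support hq.2.1 h
    rcases hqe e he with ⟨h1, -⟩ | ⟨h1, -⟩
    · exact hu e h1.1 hue
    · exact h1.2 (hB.eq_of_mem h1.1 huB hue (by simp))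
  have hvn : v ∉ q.support := by
    intro h
    obtain ⟨e, he, hve⟩ := SimpleGraph.Walk.exists_mem_edges_of_mem_support hq.2.1 h
    rcases hqe e he with ⟨h1, -⟩ | ⟨h1, -⟩
    · exact h1.2 (hA.eq_of_mem h1.1 hvA hve (by simp))
    · exact h1.2 (hB.eq_of_mem h1.1 huB hve (by simp))
  have hne1 : ∀ e ∈ q.edges, e ≠ s(u, v) := by
    rintro e he rfl
    exact hun (q.fst_mem_support_of_mem_edges he)
  have hne2 : ∀ e ∈ q.edges, e ≠ s(v, w) := by
    rintro e he rfl
    exact hvn (q.fst_mem_support_of_mem_edges he)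
  have hiff : ∀ e ∈ q.edges, (e ∈ A \ {s(v, w)} ↔ e ∈ A) := fun e he => by
    simp [hne2 e he]
  have hqe' : ∀ e ∈ q.edges, e ∈ symmDiff A B := by
    intro e he
    have := hqe e he
    simpa [Set.mem_symmDiff, hne1 e he, hne2 e he] using this
  have halt : Alternates A q.edges := hq.alternates.congr hiff
  have hfree : ∀ x ∈ q.support, x ≠ w → (∀ e ∈ A \ {s(v, w)}, x ∉ e) → ∀ e ∈ A, x ∉ e := by
    intro x hx hxw hfr e he hxe
    by_cases hevw : e = s(v, w)
    · subst hevw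
      rcases Sym2.mem_iff.1 hxe with rfl | rfl
      · exact hvn hx
      · exact hxw rfl
    · exact hfr e ⟨he, hevw⟩ hxe
  by_cases hwa : w = a ∨ w = b
  · -- extend `q` at its end `w` by the two deleted edges
    obtain ⟨b', q', hq', hedge, hsupp⟩ : ∃ (b' : V) (q' : G.Walk w b'),
        IsAugPath (A \ {s(v, w)}) q' ∧ (∀ e, e ∈ q'.edges ↔ e ∈ q.edges) ∧
          ∀ x, x ∈ q'.support ↔ x ∈ q.support := by
      rcases hwa with rfl | rfl
      · exact ⟨b, q, hq, fun _ => Iff.rfl, fun _ => Iff.rfl⟩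
      · exact ⟨a, q.reverse, hq.reverse, by simp, by simp⟩
    have huv : G.Adj u v := hB.1 huB
    have hvw : G.Adj v w := hA.1 hvA
    have hvwB : s(v, w) ∉ B := by
      intro h
      have := hB.eq_of_mem huB h (x := v) (by simp) (by simp)
      have hmem : u ∈ s(v, w) := this ▸ Sym2.mem_mk_left u v
      exact hu _ hvA hmem
    have huvA : s(u, v) ∉ A := fun h => hu _ h (by simp)
    have hub' : u ≠ b' := by
      rintro rfl
      exact hun ((hsupp _).1 q'.end_mem_support)
    refine ⟨u, b', .cons huv (.cons hvw q'), ⟨?_, hub', ?_, hu, ?_⟩, ?_⟩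
    · simp only [SimpleGraph.Walk.cons_isPath_iff, SimpleGraph.Walk.support_cons, List.mem_cons,
        hsupp, not_or]
      exact ⟨⟨hq'.1, hvn⟩, huv.ne, hun⟩
    · have halt' : Alternates A q'.edges :=
        hq'.alternates.congr fun e he => hiff e ((hedge e).1 he)
      have : Alternates A (s(u, v) :: s(v, w) :: q'.edges) := by
        rw [Alternates, List.isChain_cons_cons, List.isChain_cons]
        refine ⟨by tauto, fun e he => ?_, halt'⟩
        have he' : e ∈ q'.edges := List.mem_of_mem_head? he
        have hwe : w ∈ e := by
          cases q' with
          | nil => simp at he'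
          | cons h r =>
            simp only [SimpleGraph.Walk.edges_cons, List.head?_cons, Option.mem_def,
              Option.some.injEq] at he
            simp [← he]
        have heA : e ∉ A := fun h =>
          hq'.2.2.2.1 e ((hiff e ((hedge e).1 he')).2 h) hwe
        tauto
      exact this
    · exact hfree b' ((hsupp _).1 q'.end_mem_support) hq'.2.1.symm hq'.2.2.2.2
    · intro e he
      simp only [SimpleGraph.Walk.edges_cons, List.mem_cons] at he
      rcases he with rfl | rfl | he
      · exact Or.inr ⟨huB, huvA⟩
      · exact Or.inl ⟨hvA, hvwB⟩
      · exact hqe' e ((hedge e).1 he)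
  · push Not at hwa
    exact ⟨a, b, q, ⟨hq.1, hq.2.1, halt, hfree a q.start_mem_support hwa.1.symm hq.2.2.2.1,
      hfree b q.end_mem_support hwa.2.symm hq.2.2.2.2⟩, hqe'⟩

/-- If `B` is a larger matching than `A`, some `A`-augmenting path lies in `A ⊕ B`. -/
theorem exists_augPath_of_ncard_lt [Finite V] (hA : IsEdgeMatching G A) (hB : IsEdgeMatching G B)
    (h : A.ncard < B.ncard) :
    ∃ (c d : V) (p : G.Walk c d), IsAugPath A p ∧ ∀ e ∈ p.edges, e ∈ symmDiff A B := by
  induction hn : A.ncard using Nat.strong_induction_on generalizing A B with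
  | h n ih =>
    obtain ⟨u, v, huB, hu⟩ := hA.exists_covered_of_ncard_lt hB h
    have huv : G.Adj u v := hB.1 huB
    by_cases hv : ∃ e ∈ A, v ∈ e
    · obtain ⟨e, he, hve⟩ := hv
      obtain ⟨w, rfl⟩ := Sym2.mem_iff_exists.1 hve
      have h1 := Set.ncard_sdiff_singleton_add_one he
      have h2 := Set.ncard_sdiff_singleton_add_one huB
      obtain ⟨a, b, q, hq, hqe⟩ := ih _ (by lia) (A := A \ {s(v, w)}) (B := B \ {s(u, v)})
        (hA.subset Set.sdiff_subset) (hB.subset Set.sdiff_subset) (by lia) rfl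
      exact exists_augPath_of_delete hA hB huB he hu hq hqe
    · push Not at hv
      refine ⟨u, v, huv.toWalk, ⟨by simp [huv.ne], huv.ne, ?_, hu, hv⟩, ?_⟩
      · exact List.isChain_singleton _
      · intro e he
        obtain rfl : e = s(u, v) := by simpa [SimpleGraph.Adj.toWalk] using he
        exact Or.inr ⟨huB, fun h => hu _ h (by simp)⟩

/-- If all `A`-augmenting paths have length at least `k`, then a matching with `n` more edges than
`A` differs from `A` in at least `n * k` edges. -/
theorem mul_le_ncard_symmDiff [Finite V] {k n : ℕ} (hA : IsEdgeMatching G A)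
    (hshort : ∀ (u v : V) (p : G.Walk u v), IsAugPath A p → k ≤ p.length)
    (hB : IsEdgeMatching G B) (hn : B.ncard = A.ncard + n) :
    n * k ≤ (symmDiff A B).ncard := by
  induction n generalizing B with
  | zero => simp
  | succ n ih =>
    obtain ⟨u, v, p, hp, hpe⟩ := exists_augPath_of_ncard_lt hA hB (by lia)
    have hiff : ∀ e ∈ p.edges, (e ∈ A ↔ e ∉ B) := fun e he => by
      have := hpe e he
      rw [Set.mem_symmDiff] at this
      tauto
    have hend : ∀ x ∈ p.support, (∀ e ∈ A, x ∉ e) → ∀ e ∈ B, x ∈ e → e ∈ p.edges := by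
      intro x hx hfree e he hxe
      obtain ⟨f, hf, hxf⟩ := SimpleGraph.Walk.exists_mem_edges_of_mem_support hp.2.1 hx
      have hfB : f ∈ B := by
        have := hiff f hf
        have := hfree f
        tauto
      rwa [hB.eq_of_mem he hfB hxe hxf]
    have hB' : IsEdgeMatching G (symmDiff B {e | e ∈ p.edges}) :=
      hB.symmDiff_path hp.1 (hp.alternates.compl hiff) (hend u p.start_mem_support hp.2.2.2.1)
        (hend v p.end_mem_support hp.2.2.2.2)
    have hE := hp.1.isTrail.edges_nodup.ncard_eq_length
    have hEA := hp.two_mul_ncard_inter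
    have hsplit := Set.ncard_inter_add_ncard_sdiff_eq_ncard {e | e ∈ p.edges} A
    have hEB : {e | e ∈ p.edges} \ A = B ∩ {e | e ∈ p.edges} := by
      ext e
      have := hiff e
      simp only [Set.mem_sdiff, Set.mem_inter_iff, Set.mem_ofPred_eq]
      tauto
    have hc1 := Set.ncard_symmDiff_add B {e | e ∈ p.edges}
    have hc2 := Set.ncard_symmDiff_add (symmDiff A B) {e | e ∈ p.edges}
    have hint : symmDiff A B ∩ {e | e ∈ p.edges} = {e | e ∈ p.edges} :=
      Set.inter_eq_right.2 hpe
    rw [hEB] at hsplit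
    rw [hint, symmDiff_assoc] at hc2
    have hlen := p.length_edges
    have hk := hshort u v p hp
    have := ih hB' (by lia)
    rw [Nat.succ_mul]
    lia

end Berge

section DisjointPaths

variable {V : Type*} {G : SimpleGraph V} {M : Set (Sym2 V)} {P : Set (PathSig G)}

lemma edge_mem_of_mem_support (hPdisj : ∀ p ∈ P, ∀ q ∈ P, p ≠ q → VDisj p q) {p : PathSig G}
    (hp : p ∈ P) {x : V} (hx : x ∈ p.2.2.support) {e : Sym2 V} (hxe : x ∈ e) :
    e ∈ pathsEdges P ↔ e ∈ p.2.2.edges := by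
  refine ⟨?_, fun he => ⟨p, hp, he⟩⟩
  rintro ⟨q, hq, he⟩
  by_cases hpq : p = q
  · exact hpq ▸ he
  · exact absurd (SimpleGraph.Walk.mem_support_of_mem_of_mem_edges he hxe)
      (hPdisj p hp q hq hpq x hx)

lemma IsEdgeMatching.symmDiff_pathsEdges (hM : IsEdgeMatching G M)
    (hPaug : ∀ p ∈ P, IsAugPath M p.2.2)
    (hPdisj : ∀ p ∈ P, ∀ q ∈ P, p ≠ q → VDisj p q) :
    IsEdgeMatching G (symmDiff M (pathsEdges P)) := by
  refine ⟨?_, fun e he f hf hne x ⟨hxe, hxf⟩ => hne ?_⟩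
  · rintro e (⟨he, -⟩ | ⟨⟨p, -, he⟩, -⟩)
    · exact hM.1 he
    · exact p.2.2.edges_subset_edgeSet he
  · by_cases hx : ∃ p ∈ P, x ∈ p.2.2.support
    · obtain ⟨p, hp, hx⟩ := hx
      refine (hPaug p hp).symmDiff_unique_of_mem_support hM hx ?_ ?_ hxe hxf
      · simpa [Set.mem_symmDiff, edge_mem_of_mem_support hPdisj hp hx hxe] using he
      · simpa [Set.mem_symmDiff, edge_mem_of_mem_support hPdisj hp hx hxf] using hf
    · have key : ∀ g, x ∈ g → g ∈ symmDiff M (pathsEdges P) → g ∈ M := by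
        rintro g hxg (⟨hg, -⟩ | ⟨⟨p, hp, hg⟩, -⟩)
        · exact hg
        · exact absurd ⟨p, hp, SimpleGraph.Walk.mem_support_of_mem_of_mem_edges hg hxg⟩ hx
      exact hM.eq_of_mem (key e hxe he) (key f hxf hf) hxe hxf

lemma finite_of_vDisj [Finite V] (hPdisj : ∀ p ∈ P, ∀ q ∈ P, p ≠ q → VDisj p q) : P.Finite := by
  refine Set.Finite.of_injOn (f := fun p : PathSig G => p.1) (t := Set.univ)
    (fun _ _ => Set.mem_univ _) ?_ Set.finite_univ
  intro p hp q hq hpq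
  by_contra hne
  refine hPdisj p hp q hq hne p.1 p.2.2.start_mem_support ?_
  have : p.1 = q.1 := hpq
  rw [this]
  exact q.2.2.start_mem_support

lemma pairwiseDisjoint_edges (hPdisj : ∀ p ∈ P, ∀ q ∈ P, p ≠ q → VDisj p q) :
    P.PairwiseDisjoint fun p => {e | e ∈ p.2.2.edges} := by
  intro p hp q hq hpq
  refine Set.disjoint_left.2 fun e he he' => ?_
  exact hPdisj p hp q hq hpq _
    (SimpleGraph.Walk.mem_support_of_mem_of_mem_edges he e.out_fst_mem)
    (SimpleGraph.Walk.mem_support_of_mem_of_mem_edges he' e.out_fst_mem)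

lemma pathsEdges_eq_biUnion : pathsEdges P = ⋃ p ∈ P, {e | e ∈ p.2.2.edges} := by
  ext e
  simp [pathsEdges]

lemma ncard_pathsEdges [Finite V] {k : ℕ}
    (hPaug : ∀ p ∈ P, IsAugPath M p.2.2 ∧ p.2.2.length = k)
    (hPdisj : ∀ p ∈ P, ∀ q ∈ P, p ≠ q → VDisj p q) :
    (pathsEdges P).ncard = P.ncard * k := by
  rw [pathsEdges_eq_biUnion]
  refine (finite_of_vDisj hPdisj).ncard_biUnion_const (fun _ _ => Set.toFinite _)
    (pairwiseDisjoint_edges hPdisj) fun p hp => ?_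
  rw [(hPaug p hp).1.1.isTrail.edges_nodup.ncard_eq_length, SimpleGraph.Walk.length_edges,
    (hPaug p hp).2]

lemma ncard_pathsEdges_inter [Finite V] {c : ℕ}
    (hPaug : ∀ p ∈ P, IsAugPath M p.2.2 ∧ p.2.2.length = 2 * c + 1)
    (hPdisj : ∀ p ∈ P, ∀ q ∈ P, p ≠ q → VDisj p q) :
    (M ∩ pathsEdges P).ncard = P.ncard * c := by
  have : M ∩ pathsEdges P = ⋃ p ∈ P, ({e | e ∈ p.2.2.edges} ∩ M) := by
    rw [pathsEdges_eq_biUnion, Set.inter_comm, Set.iUnion₂_inter]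
  rw [this]
  refine (finite_of_vDisj hPdisj).ncard_biUnion_const (fun _ _ => Set.toFinite _)
    ((pairwiseDisjoint_edges hPdisj).mono fun _ => Set.inter_subset_left) fun p hp => ?_
  have := (hPaug p hp).1.two_mul_ncard_inter
  have := (hPaug p hp).2
  lia

/-- A path augmenting for `M ⊕ E(P)` that misses all paths of `P` is `M`-augmenting. -/
lemma IsAugPath.of_symmDiff_pathsEdges {u v : V} {q : G.Walk u v}
    (hq : IsAugPath (symmDiff M (pathsEdges P)) q)
    (hdisj : ∀ p ∈ P, ∀ x ∈ q.support, x ∉ p.2.2.support) : IsAugPath M q := by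
  have hnot : ∀ x ∈ q.support, ∀ e, x ∈ e → e ∉ pathsEdges P := by
    rintro x hx e hxe ⟨p, hp, he⟩
    exact hdisj p hp x hx (SimpleGraph.Walk.mem_support_of_mem_of_mem_edges he hxe)
  refine ⟨hq.1, hq.2.1, ?_, fun e he hue => ?_, fun e he hve => ?_⟩
  · have : Alternates M q.edges := hq.alternates.congr fun e he => by
      have := hnot _ (SimpleGraph.Walk.mem_support_of_mem_of_mem_edges he e.out_fst_mem) e
        e.out_fst_mem
      simp [Set.mem_symmDiff, this]
    exact this
  · exact hq.2.2.2.1 e (Or.inl ⟨he, hnot u q.start_mem_support e hue⟩) hue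
  · exact hq.2.2.2.2 e (Or.inl ⟨he, hnot v q.end_mem_support e hve⟩) hve

/-- A path augmenting for `M ⊕ E(P)` that meets a path of `P` shares an edge with it. -/
lemma IsAugPath.inter_pathsEdges_nonempty {u v : V} {q : G.Walk u v}
    (hM' : IsEdgeMatching G (symmDiff M (pathsEdges P)))
    (hq : IsAugPath (symmDiff M (pathsEdges P)) q) {p : PathSig G} (hp : p ∈ P)
    (hpaug : IsAugPath M p.2.2) {x : V} (hxq : x ∈ q.support) (hxp : x ∈ p.2.2.support) :
    (pathsEdges P ∩ {e | e ∈ q.edges}).Nonempty := by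
  obtain ⟨e, he, hxe, heM⟩ := hpaug.exists_edge_notMem hxp
  have heM' : e ∈ symmDiff M (pathsEdges P) := Or.inr ⟨⟨p, hp, he⟩, heM⟩
  obtain ⟨f, hf, hxf, hfM'⟩ := hq.exists_edge_mem hxq
    (fun h => hq.2.2.2.1 e heM' (h ▸ hxe)) (fun h => hq.2.2.2.2 e heM' (h ▸ hxe))
  obtain rfl := hM'.eq_of_mem heM' hfM' hxe hxf
  exact ⟨e, ⟨p, hp, he⟩, hf⟩

end DisjointPaths

/-- **Hopcroft–Karp.** Let `M` be a matching in `G`, suppose an `M`-augmenting path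
exists, and let `k` be the length of a shortest `M`-augmenting path. Let `P` be a
maximal collection of pairwise vertex-disjoint `M`-augmenting paths of length exactly
`k`. Then `M ⊕ E(P)` is a matching and every `M ⊕ E(P)`-augmenting path has length at
least `k + 2`. -/
theorem hopcroft_karp {V : Type*} [Fintype V] [DecidableEq V] (G : SimpleGraph V)
    (M : Set (Sym2 V)) (hM : IsEdgeMatching G M) (k : ℕ)
    (hex : ∃ (u v : V) (p : G.Walk u v), IsAugPath M p ∧ p.length = k)
    (hshort : ∀ (u v : V) (p : G.Walk u v), IsAugPath M p → k ≤ p.length)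
    (P : Set (PathSig G))
    (hPaug : ∀ p ∈ P, IsAugPath M p.2.2 ∧ p.2.2.length = k)
    (hPdisj : ∀ p ∈ P, ∀ q ∈ P, p ≠ q → VDisj p q)
    (hPmax : ∀ q : PathSig G, IsAugPath M q.2.2 → q.2.2.length = k → q ∉ P →
        ∃ p ∈ P, ¬ VDisj q p) :
    IsEdgeMatching G (symmDiff M (pathsEdges P)) ∧
      ∀ (u v : V) (p : G.Walk u v), IsAugPath (symmDiff M (pathsEdges P)) p →
        k + 2 ≤ p.length := by
  have hM' : IsEdgeMatching G (symmDiff M (pathsEdges P)) :=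
    hM.symmDiff_pathsEdges (fun p hp => (hPaug p hp).1) hPdisj
  refine ⟨hM', fun u v q hq => ?_⟩
  have hqlen := hq.two_mul_ncard_inter
  obtain ⟨c, rfl⟩ : ∃ c, k = 2 * c + 1 := by
    obtain ⟨a, b, p, hp, rfl⟩ := hex
    exact ⟨_, hp.two_mul_ncard_inter.symm⟩
  by_cases hdisj : ∀ p ∈ P, ∀ x ∈ q.support, x ∉ p.2.2.support
  · have hqM := hq.of_symmDiff_pathsEdges hdisj
    have hge := hshort u v q hqM
    have hne : q.length ≠ 2 * c + 1 := by
      intro hlen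
      have hqP : (⟨u, v, q⟩ : PathSig G) ∉ P := fun h =>
        hdisj _ h u q.start_mem_support q.start_mem_support
      obtain ⟨p, hp, hnd⟩ := hPmax ⟨u, v, q⟩ hqM hlen hqP
      exact hnd (hdisj p hp)
    lia
  · push Not at hdisj
    obtain ⟨p, hp, x, hxq, hxp⟩ := hdisj
    have hpos := (Set.ncard_pos (Set.toFinite _)).2
      (hq.inter_pathsEdges_nonempty hM' hp (hPaug p hp).1 hxq hxp)
    have hE := ncard_pathsEdges hPaug hPdisj
    have hEM := ncard_pathsEdges_inter hPaug hPdisj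
    have hF := hq.1.isTrail.edges_nodup.ncard_eq_length
    rw [SimpleGraph.Walk.length_edges] at hF
    have h1 := Set.ncard_symmDiff_add M (pathsEdges P)
    have h2 := Set.ncard_symmDiff_add (symmDiff M (pathsEdges P)) {e | e ∈ q.edges}
    have h3 := Set.ncard_symmDiff_add (pathsEdges P) {e | e ∈ q.edges}
    rw [Set.inter_comm] at hqlen
    have hcard : P.ncard * (2 * c + 1) = 2 * (P.ncard * c) + P.ncard := by ring
    have hbound := mul_le_ncard_symmDiff (n := P.ncard + 1) hM hshort
      (hq.isEdgeMatching_symmDiff hM') (by lia)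
    rw [symmDiff_assoc, symmDiff_symmDiff_cancel_left, Nat.succ_mul] at hbound
    lia
end

section
/- Let M* be a maximum cardinality matching and let M be a matching in a finite simple graph G. Let k ≥ 1 be an integer and suppose every M-augmenting path in G has length at least 2k + 1 (in particular this holds vacuously if no M-augmenting path exists). Then (k+1)·|M| ≥ k·|M*|, i.e., |M| ≥ (k/(k+1))·|M*|. -/
open Finset in
/-- If an injective map `f` is iterated from `C \ D`, keeping only points of `C`, and the first `k`
images stay in `D`, then `k * #C ≤ (k + 1) * #D`. -/
theorem mul_card_le_of_iterate_image {V : Type*} [DecidableEq V] {f : V → V}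
    (hf : Function.Injective f) (C D : Finset V) (A : ℕ → Finset V) (k : ℕ)
    (hzero : A 0 = C \ D) (hsucc : ∀ i, A (i + 1) = (A i).image f ∩ C)
    (hD : ∀ i < k, (A i).image f ⊆ D) : k * #C ≤ (k + 1) * #D := by
  have hdisj : ∀ i j, i < j → j < k → Disjoint ((A i).image f) ((A j).image f) := by
    intro i
    induction i with
    | zero =>
      intro j hij hj
      obtain ⟨j, rfl⟩ := Nat.exists_eq_succ_of_ne_zero hij.ne'
      rw [disjoint_image hf, hzero, hsucc]
      exact disjoint_sdiff.symm.mono_right (inter_subset_left.trans (hD j (by omega)))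
    | succ i ih =>
      intro j hij hj
      obtain ⟨j, rfl⟩ := Nat.exists_eq_succ_of_ne_zero (by omega : j ≠ 0)
      rw [disjoint_image hf, hsucc, hsucc]
      exact (ih j (by omega) (by omega)).mono inter_subset_left inter_subset_left
  have hpair : ∀ i < k, ∀ j < k, i ≠ j → Disjoint ((A i).image f) ((A j).image f) := by
    intro i hi j hj hij
    rcases lt_or_gt_of_ne hij with h | h
    · exact hdisj i j h hj
    · exact (hdisj j i h hi).symm
  have hstep : ∀ i, #(A (i + 1)) + #((A i).image f \ C) = #(A i) := by
    intro i
    rw [hsucc, card_inter_add_card_sdiff, card_image_of_injective _ hf]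
  have hsum : ∀ i, #(A i) + ∑ j ∈ range i, #((A j).image f \ C) = #(A 0) := by
    intro i
    induction i with
    | zero => simp
    | succ i ih => rw [sum_range_succ]; have := hstep i; omega
  have hlost : ∀ i ≤ k, ∑ j ∈ range i, #((A j).image f \ C) ≤ #(D \ C) := by
    intro i hi
    rw [← card_biUnion]
    · refine card_le_card (biUnion_subset.2 fun j hj => ?_)
      exact sdiff_subset_sdiff (hD j (by simp at hj; omega)) le_rfl
    · intro a ha b hb hab
      simp at ha hb
      exact (hpair a (by omega) b (by omega) hab).mono sdiff_subset sdiff_subset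
  have htotal : ∑ j ∈ range k, #(A j) ≤ #D := by
    rw [sum_congr rfl fun j _ => (card_image_of_injective (A j) hf).symm, ← card_biUnion]
    · exact card_le_card (biUnion_subset.2 fun j hj => hD j (by simpa using hj))
    · intro a ha b hb hab
      simp at ha hb
      exact hpair a ha b hb hab
  have hC : #C ≤ #(A 0) + #D - #(D \ C) := by
    have h1 := card_sdiff_add_card_inter C D
    have h2 := card_sdiff_add_card_inter D C
    rw [inter_comm] at h2
    rw [hzero]
    omega
  have hle : k * (#C - #D) ≤ ∑ j ∈ range k, #(A j) := by
    have := card_nsmul_le_sum (range k) (fun j => #(A j)) (#C - #D) (fun j hj => by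
      have h1 := hsum j
      have h2 := hlost j (by simp at hj; omega)
      have h3 : #(D \ C) ≤ #D := card_le_card sdiff_subset
      omega)
    simpa using this
  have h : k * #C ≤ k * (#C - #D) + k * #D := by
    rw [← mul_add]
    exact Nat.mul_le_mul_left k (by omega)
  linarith

/-- `m` sends each vertex covered by `M` to its partner and fixes the `M`-free vertices. -/
def IsPartner {V : Type*} (M : Set (Sym2 V)) (m : V → V) : Prop :=
  Function.Involutive m ∧ (∀ v, m v ≠ v → s(v, m v) ∈ M) ∧ ∀ u v, s(u, v) ∈ M → m u = v

theorem IsEdgeMatching.exists_isPartner {V : Type*} {G : SimpleGraph V} {M : Set (Sym2 V)}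
    (hM : IsEdgeMatching G M) : ∃ m, IsPartner M m := by
  classical
  have huniq : ∀ u v w, s(u, v) ∈ M → s(u, w) ∈ M → v = w := by
    intro u v w hv hw
    by_contra hne
    refine hM.2 _ hv _ hw (fun h => hne ?_) u ⟨by simp, by simp⟩
    exact Sym2.congr_right.1 h
  let m : V → V := fun v => if h : ∃ w, s(v, w) ∈ M then h.choose else v
  have hpartner : ∀ u v, s(u, v) ∈ M → m u = v := by
    intro u v h
    have h' : ∃ w, s(u, w) ∈ M := ⟨v, h⟩
    simp only [m, dif_pos h']
    exact huniq u _ _ h'.choose_spec h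
  have hmem : ∀ v, m v ≠ v → s(v, m v) ∈ M := by
    intro v hv
    by_cases h : ∃ w, s(v, w) ∈ M
    · simp only [m, dif_pos h]
      exact h.choose_spec
    · exact absurd (by simp only [m, dif_neg h]) hv
  refine ⟨m, fun v => ?_, hmem, hpartner⟩
  by_cases h : m v = v
  · rw [h, h]
  · exact hpartner _ _ (Sym2.eq_swap ▸ hmem v h)

theorem IsPartner.ne {V : Type*} {G : SimpleGraph V} {M : Set (Sym2 V)} {m : V → V}
    (hm : IsPartner M m) (hM : M ⊆ G.edgeSet) {u v : V} (h : s(u, v) ∈ M) : m u ≠ u := by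
  rw [hm.2.2 u v h]
  exact (G.ne_of_adj (hM h)).symm

theorem IsPartner.free {V : Type*} {G : SimpleGraph V} {M : Set (Sym2 V)} {m : V → V}
    (hm : IsPartner M m) (hM : M ⊆ G.edgeSet) {v : V} (hv : m v = v) : ∀ e ∈ M, v ∉ e := by
  rintro e he hve
  obtain ⟨w, rfl⟩ := Sym2.mem_iff_exists.1 hve
  exact hm.ne hM he hv

theorem IsPartner.card_covered {V : Type*} [Fintype V] [DecidableEq V] {G : SimpleGraph V}
    {M : Set (Sym2 V)} {m : V → V} (hm : IsPartner M m) (hM : M ⊆ G.edgeSet) :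
    (Finset.univ.filter fun v => m v ≠ v).card = 2 * M.ncard := by
  classical
  have hfin : M.Finite := M.toFinite
  rw [Set.ncard_eq_toFinset_card M hfin,
    Finset.card_eq_sum_card_fiberwise (f := fun v => s(v, m v)) (t := hfin.toFinset)
      (fun v hv => by simpa using hm.2.1 v (by simpa using hv)),
    Finset.sum_const_nat (m := 2), mul_comm]
  intro e he
  induction e with | _ u v => ?_
  have huv : s(u, v) ∈ M := by simpa using he
  have hvu : s(v, u) ∈ M := Sym2.eq_swap ▸ huv
  have hne : u ≠ v := G.ne_of_adj (hM huv)
  rw [← Finset.card_pair hne]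
  congr 1
  ext w
  have h1 := hm.2.2 u v huv
  have h2 := hm.2.2 v u hvu
  simp only [Finset.mem_filter, Finset.mem_univ, true_and, Finset.mem_insert,
    Finset.mem_singleton, Sym2.eq_iff]
  grind

/-- `p` is a path alternating between `M` and its complement whose first edge, if any, is in `M`,
whose last vertex is `M`-free, and whose support is closed under the partner maps `m` and `n`,
except at the first vertex for `n`. -/
structure IsPartialAug {V : Type*} {G : SimpleGraph V} (M : Set (Sym2 V)) (m n : V → V)
    {x a : V} (p : G.Walk x a) : Prop where
  isPath : p.IsPath
  chain : List.IsChain (fun e f => ¬(e ∈ M ↔ f ∈ M)) p.edges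
  head : ∀ e ∈ p.edges.head?, e ∈ M
  free : m a = a
  closed_left : ∀ y ∈ p.support, m y ∈ p.support
  closed_right : ∀ y ∈ p.support, y ≠ x → n y ∈ p.support ∧ n y ≠ x

namespace IsPartialAug

variable {V : Type*} {G : SimpleGraph V} {M N : Set (Sym2 V)} {m n : V → V} {x a : V}
  {p : G.Walk x a}

theorem nil {a : V} (ha : m a = a) : IsPartialAug M m n (.nil : G.Walk a a) where
  isPath := by simp
  chain := by simp
  head := by simp
  free := ha
  closed_left := by simp [ha]
  closed_right := by simp

theorem notMem_support (h : IsPartialAug M m n p) (hn : Function.Involutive n) (hx : n x ≠ x) :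
    n x ∉ p.support := fun hmem => (h.closed_right _ hmem hx).2 (hn x)

theorem isPath_cons (h : IsPartialAug M m n p) (hn : Function.Involutive n) (hx : n x ≠ x)
    (hadj : G.Adj (n x) x) : (p.cons hadj).IsPath :=
  h.isPath.cons (h.notMem_support hn hx)

theorem edge_notMem (h : IsPartialAug M m n p) (hm : IsPartner M m) (hn : Function.Involutive n)
    (hx : n x ≠ x) : s(n x, x) ∉ M := by
  intro he
  have := h.closed_left x p.start_mem_support
  rw [hm.2.2 x (n x) (Sym2.eq_swap ▸ he)] at this
  exact h.notMem_support hn hx this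

theorem chain_cons (h : IsPartialAug M m n p) (hm : IsPartner M m) (hn : Function.Involutive n)
    (hx : n x ≠ x) (hadj : G.Adj (n x) x) :
    List.IsChain (fun e f => ¬(e ∈ M ↔ f ∈ M)) (p.cons hadj).edges := by
  rw [SimpleGraph.Walk.edges_cons, List.isChain_cons]
  refine ⟨fun e he => ?_, h.chain⟩
  have h1 := h.edge_notMem hm hn hx
  have h2 := h.head e he
  tauto

theorem isAugPath_cons (h : IsPartialAug M m n p) (hM : M ⊆ G.edgeSet) (hm : IsPartner M m)
    (hn : Function.Involutive n) (hx : n x ≠ x) (hfree : m (n x) = n x) (hadj : G.Adj (n x) x) :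
    IsAugPath M (p.cons hadj) := by
  refine ⟨h.isPath_cons hn hx hadj, ?_, h.chain_cons hm hn hx hadj, hm.free hM hfree,
    hm.free hM h.free⟩
  intro heq
  exact h.notMem_support hn hx (heq ▸ p.end_mem_support)

theorem cons_cons (h : IsPartialAug M m n p) (hm : IsPartner M m)
    (hn : Function.Involutive n) (hx : n x ≠ x) (hcov : m (n x) ≠ n x) (hadj : G.Adj (n x) x)
    (hadj' : G.Adj (m (n x)) (n x)) : IsPartialAug M m n ((p.cons hadj).cons hadj') := by
  have hnx := h.notMem_support hn hx
  have hmnx : m (n x) ∉ p.support := fun hmem =>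
    hnx (hm.1 (n x) ▸ h.closed_left _ hmem)
  have he : s(m (n x), n x) ∈ M := Sym2.eq_swap ▸ hm.2.1 (n x) hcov
  refine ⟨?_, ?_, ?_, h.free, ?_, ?_⟩
  · exact (h.isPath_cons hn hx hadj).cons (by simp [hcov, hmnx])
  · rw [SimpleGraph.Walk.edges_cons, List.isChain_cons]
    refine ⟨fun e hmem => ?_, h.chain_cons hm hn hx hadj⟩
    have h1 := h.edge_notMem hm hn hx
    simp only [SimpleGraph.Walk.edges_cons, List.head?_cons, Option.mem_def,
      Option.some.injEq] at hmem
    subst hmem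
    tauto
  · simpa using he
  · intro y hy
    simp only [SimpleGraph.Walk.support_cons, List.mem_cons] at hy ⊢
    rcases hy with rfl | rfl | hy
    · exact .inr (.inl (hm.1 _))
    · exact .inl rfl
    · exact .inr (.inr (h.closed_left y hy))
  · intro y hy hne
    simp only [SimpleGraph.Walk.support_cons, List.mem_cons] at hy ⊢
    have hxs := p.start_mem_support
    rcases hy with rfl | rfl | hy
    · exact absurd rfl hne
    · rw [hn x]
      exact ⟨.inr (.inr hxs), fun heq => hmnx (heq ▸ hxs)⟩
    · by_cases hyx : y = x
      · subst hyx
        exact ⟨.inr (.inl rfl), hcov.symm⟩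
      · have hny := (h.closed_right y hy hyx).1
        exact ⟨.inr (.inr hny), fun heq => hmnx (heq ▸ hny)⟩

end IsPartialAug

/-- **[Nguyen–Onak, Lemma 6].** Let `Mstar` be a maximum cardinality matching and `M`
a matching in a finite simple graph `G`, let `k ≥ 1`, and suppose every `M`-augmenting
path in `G` has length at least `2k + 1`. Then `(k+1)·|M| ≥ k·|Mstar|`. -/
theorem matching_approx_of_no_short_aug_path {V : Type*} [Fintype V] [DecidableEq V]
    (G : SimpleGraph V) (M Mstar : Set (Sym2 V))
    (hM : IsEdgeMatching G M) (hMstar : IsEdgeMatching G Mstar)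
    (hmax : ∀ M' : Set (Sym2 V), IsEdgeMatching G M' → M'.ncard ≤ Mstar.ncard)
    (k : ℕ) (hk : 1 ≤ k)
    (hlong : ∀ (u v : V) (p : G.Walk u v), IsAugPath M p → 2 * k + 1 ≤ p.length) :
    k * Mstar.ncard ≤ (k + 1) * M.ncard := by
  obtain ⟨m, hm⟩ := hM.exists_isPartner
  obtain ⟨n, hn⟩ := hMstar.exists_isPartner
  let D := Finset.univ.filter fun v => m v ≠ v
  let C := Finset.univ.filter fun v => n v ≠ v
  let A : ℕ → Finset V := fun i => Nat.rec (C \ D) (fun _ S => S.image (m ∘ n) ∩ C) i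
  have hAC : ∀ i, A i ⊆ C := by
    rintro (_ | i)
    · exact Finset.sdiff_subset
    · exact Finset.inter_subset_right
  have hadj : ∀ x ∈ C, G.Adj (n x) x := fun x hx =>
    (hMstar.1 (hn.2.1 x (by simpa [C] using hx)) : G.Adj _ _).symm
  have hcov : ∀ i < k, ∀ x ∈ A i, ∀ (a : V) (p : G.Walk x a), IsPartialAug M m n p →
      p.length = 2 * i → m (n x) ≠ n x := by
    intro i hi x hx a p hp hlen hfree
    have hxC := hAC i hx
    have := hlong _ _ _ (hp.isAugPath_cons hM.1 hm hn.1 (by simpa [C] using hxC) hfree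
      (hadj x hxC))
    rw [SimpleGraph.Walk.length_cons] at this
    omega
  have hpath : ∀ i ≤ k, ∀ x ∈ A i, ∃ (a : V) (p : G.Walk x a), IsPartialAug M m n p ∧
      p.length = 2 * i := by
    intro i
    induction i with
    | zero =>
      intro _ x hx
      have hx' : x ∈ C \ D := hx
      exact ⟨x, .nil, .nil (by simpa [C, D] using (Finset.mem_sdiff.1 hx').2), rfl⟩
    | succ i ih =>
      intro hi y hy
      have hy' : y ∈ (A i).image (m ∘ n) ∩ C := hy
      obtain ⟨x, hx, rfl⟩ := Finset.mem_image.1 (Finset.mem_inter.1 hy').1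
      obtain ⟨a, p, hp, hlen⟩ := ih (by omega) x hx
      have hne := hcov i (by omega) x hx a p hp hlen
      have hxC := hAC i hx
      refine ⟨a, _, hp.cons_cons hm hn.1 (by simpa [C] using hxC) hne (hadj x hxC)
        (hM.1 (hm.2.1 _ hne) : G.Adj _ _).symm, ?_⟩
      simp [hlen]
      ring
  have hcard := mul_card_le_of_iterate_image (hm.1.injective.comp hn.1.injective) C D A k rfl
    (fun _ => rfl) (fun i hi y hy => by
      obtain ⟨x, hx, rfl⟩ := Finset.mem_image.1 hy
      obtain ⟨a, p, hp, hlen⟩ := hpath i hi.le x hx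
      have hne := hcov i hi x hx a p hp hlen
      simpa [D, hm.1 (n x)] using hne.symm)
  rw [hn.card_covered hMstar.1, hm.card_covered hM.1] at hcard
  linarith
end

section
/- Let G be a finite simple graph and let ≺₁ and ≺₂ be two linear orders on the vertex set of G such that for every edge {u,v} of G, u ≺₁ v if and only if u ≺₂ v. Then the greedy maximal independent sets coincide: I_{≺₁} = I_{≺₂}. -/
/-- **Order-agreement on edges determines the greedy MIS.** Let `G` be a finite simple
graph and let `r₁`, `r₂` be two (strict) linear orders on its vertex set that agree on
every edge of `G`. Let `I₁` (resp. `I₂`) be the greedy maximal independent set along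
`r₁` (resp. `r₂`), i.e. the unique set satisfying the well-founded recursion
`v ∈ I ↔ every neighbor u of v with u ≺ v satisfies u ∉ I`. Then `I₁ = I₂`. -/
theorem greedy_mis_order_agree {V : Type*} [Fintype V] (G : SimpleGraph V)
    (r₁ r₂ : V → V → Prop)
    (h₁ : IsStrictTotalOrder V r₁) (h₂ : IsStrictTotalOrder V r₂)
    (hagree : ∀ u v : V, G.Adj u v → (r₁ u v ↔ r₂ u v))
    (I₁ I₂ : Set V)
    (hI₁ : ∀ v : V, v ∈ I₁ ↔ ∀ u : V, G.Adj u v → r₁ u v → u ∉ I₁)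
    (hI₂ : ∀ v : V, v ∈ I₂ ↔ ∀ u : V, G.Adj u v → r₂ u v → u ∉ I₂) :
    I₁ = I₂ := by
  have hwf : WellFounded r₁ := Finite.wellFounded_of_trans_of_irrefl r₁
  ext v
  induction v using hwf.induction with
  | _ v ih =>
    rw [hI₁, hI₂]
    refine forall_congr' fun u => forall_congr' fun huv => ?_
    rw [← hagree u v huv]
    exact forall_congr' fun hlt => not_congr (ih u hlt)
end

section
/- Let M be a matching in a finite simple graph G and let p be an M-augmenting path. Then M ⊕ E(p) is a matching in G with |M ⊕ E(p)| = |M| + 1. -/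
section

variable {V : Type*} {G : SimpleGraph V} {M : Set (Sym2 V)}

theorem IsEdgeMatching.mono {N : Set (Sym2 V)} (hM : IsEdgeMatching G M) (h : N ⊆ M) :
    IsEdgeMatching G N :=
  ⟨h.trans hM.1, fun e he f hf => hM.2 e (h he) f (h hf)⟩

/-- Adding an edge between two free vertices to a matching gives a matching. -/
theorem IsEdgeMatching.insert {u v : V} (hM : IsEdgeMatching G M) (h : G.Adj u v)
    (hu : ∀ e ∈ M, u ∉ e) (hv : ∀ e ∈ M, v ∉ e) :
    IsEdgeMatching G (insert s(u, v) M) := by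
  refine ⟨Set.insert_subset h hM.1, ?_⟩
  rintro e (rfl | he) f (rfl | hf) hne x ⟨hxe, hxf⟩
  · exact hne rfl
  · rcases Sym2.mem_iff.1 hxe with rfl | rfl
    exacts [hu f hf hxf, hv f hf hxf]
  · rcases Sym2.mem_iff.1 hxf with rfl | rfl
    exacts [hu e he hxe, hv e he hxe]
  · exact hM.2 e he f hf hne x ⟨hxe, hxf⟩

/-- Removing an edge from a matching frees both of its endpoints. -/
theorem IsEdgeMatching.notMem_of_mem_diff_singleton {a b : V} (hM : IsEdgeMatching G M)
    (h : s(a, b) ∈ M) {x : V} (hx : x ∈ s(a, b)) : ∀ e ∈ M \ {s(a, b)}, x ∉ e :=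
  fun e he hxe => hM.2 e he.1 _ h he.2 x ⟨hxe, hx⟩

theorem IsAugPath.isEdgeMatching_symmDiff_and_ncard [Finite V] {M : Set (Sym2 V)} {u v : V}
    (p : G.Walk u v)
    (hM : IsEdgeMatching G M) (hp : IsAugPath M p) :
    IsEdgeMatching G (symmDiff M {e | e ∈ p.edges}) ∧
      (symmDiff M {e | e ∈ p.edges}).ncard = M.ncard + 1 := by
  match p, hp with
  | .nil, hp => exact absurd rfl hp.2.1
  | .cons h .nil, ⟨_, _, _, hu, hv⟩ =>
    have hnot : s(u, v) ∉ M := fun hmem => hu _ hmem (Sym2.mem_mk_left _ _)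
    have hS : symmDiff M {e | e ∈ (SimpleGraph.Walk.cons h .nil).edges} =
        insert s(u, v) M := by
      ext e
      simp only [Set.mem_symmDiff, SimpleGraph.Walk.edges_cons, SimpleGraph.Walk.edges_nil,
        List.mem_singleton, Set.mem_ofPred_eq, Set.mem_insert_iff]
      grind
    rw [hS]
    exact ⟨hM.insert h hu hv, Set.ncard_insert_of_notMem hnot⟩
  | .cons (v := a) h (.cons (v := b) h' q), ⟨hpath, hne, halt, hu, hv⟩ =>
    have hua : s(u, a) ∉ M := fun hmem => hu _ hmem (Sym2.mem_mk_left _ _)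
    rw [SimpleGraph.Walk.edges_cons, SimpleGraph.Walk.edges_cons, List.Chain',
      List.isChain_cons_cons] at halt
    have hab : s(a, b) ∈ M := by tauto
    simp only [SimpleGraph.Walk.cons_isPath_iff, SimpleGraph.Walk.support_cons,
      List.mem_cons, not_or] at hpath
    obtain ⟨⟨hq, haq⟩, hu_ne_a, huq⟩ := hpath
    have hub : u ≠ b := fun h => huq (h ▸ q.start_mem_support)
    have huaq : s(u, a) ∉ q.edges := fun h => huq (q.fst_mem_support_of_mem_edges h)
    have habq : s(a, b) ∉ q.edges := fun h => haq (q.fst_mem_support_of_mem_edges h)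
    have hav : a ≠ v := fun h => haq (h ▸ q.end_mem_support)
    have hfree := hM.notMem_of_mem_diff_singleton hab (Sym2.mem_mk_right a b)
    have hM' : IsEdgeMatching G (insert s(u, a) (M \ {s(a, b)})) :=
      (hM.mono Set.sdiff_subset).insert h (fun e he => hu e he.1)
        (hM.notMem_of_mem_diff_singleton hab (Sym2.mem_mk_left a b))
    have hcard : (insert s(u, a) (M \ {s(a, b)})).ncard = M.ncard := by
      rw [Set.ncard_insert_of_notMem fun h => hua h.1, Set.ncard_sdiff_singleton_add_one hab]
    have hmem : ∀ e ∈ q.edges, (e ∈ insert s(u, a) (M \ {s(a, b)}) ↔ e ∈ M) := by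
      intro e he
      simp only [Set.mem_insert_iff, Set.mem_sdiff, Set.mem_singleton_iff]
      grind
    have hq' : IsAugPath (insert s(u, a) (M \ {s(a, b)})) q := by
      refine ⟨hq, fun hbv => hv _ hab (hbv ▸ Sym2.mem_mk_right a b), ?_, ?_, ?_⟩
      · refine List.IsChain.imp_of_mem_imp (fun e f he hf hef => ?_) halt.2.tail
        rwa [hmem e he, hmem f hf]
      · rintro e (rfl | he) hbe
        · rcases Sym2.mem_iff.1 hbe with rfl | rfl
          exacts [hub rfl, h'.ne rfl]
        · exact hfree e he hbe
      · rintro e (rfl | he) hve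
        · rcases Sym2.mem_iff.1 hve with rfl | rfl
          exacts [hne rfl, hav rfl]
        · exact hv e he.1 hve
    have hS : symmDiff M {e | e ∈ (SimpleGraph.Walk.cons h (.cons h' q)).edges} =
        symmDiff (insert s(u, a) (M \ {s(a, b)})) {e | e ∈ q.edges} := by
      ext e
      simp only [Set.mem_symmDiff, SimpleGraph.Walk.edges_cons, List.mem_cons,
        Set.mem_ofPred_eq, Set.mem_insert_iff, Set.mem_sdiff, Set.mem_singleton_iff]
      grind
    rw [hS, ← hcard]
    exact isEdgeMatching_symmDiff_and_ncard q hM' hq'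
termination_by p.length

end

/-- If `M` is a matching and `p` is an `M`-augmenting path, then `M ⊕ E(p)` is a
matching of cardinality `|M| + 1`. -/
theorem augment_matching {V : Type*} [Fintype V] [DecidableEq V] (G : SimpleGraph V)
    (M : Set (Sym2 V)) (hM : IsEdgeMatching G M)
    {u v : V} (p : G.Walk u v) (hp : IsAugPath M p) :
    IsEdgeMatching G (symmDiff M {e | e ∈ p.edges}) ∧
      (symmDiff M {e | e ∈ p.edges}).ncard = M.ncard + 1 := by
  exact IsAugPath.isEdgeMatching_symmDiff_and_ncard p hM hp
end
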